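/- There exists a finite nonsolvable group G that possesses no characteristic conjugacy class of nontrivial elements: for every g ∈ G with g ≠ 1 there exists an automorphism φ of G such that φ(g) is not conjugate to g in G. -/

import Mathlib

/-- The subgroup of the (unrestricted, regular) wreath product of `M` by `T` consisting of the pairs
`(f, t)` with `∑ x, f x = 0`. -/
@[ext]
structure AugWreath (T M : Type) [Fintype T] [AddCommGroup M] where
  /-- The base component. -/
  fn : T → M
  /-- The top component. -/
  top : T
  sum_fn : ∑ x, fn x = 0

namespace AugWreath

variable {T M : Type} [Fintype T] [Group T] [AddCommGroup M]

lemma sum_translate (f : T → M) (t : T) : ∑ x, f (x * t) = ∑ x, f x :=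
  Equiv.sum_comp (Equiv.mulRight t) f

instance : Mul (AugWreath T M) where
  mul a b := ⟨fun x => a.fn x + b.fn (x * a.top), a.top * b.top, by
    rw [Finset.sum_add_distrib, sum_translate, a.sum_fn, b.sum_fn, add_zero]⟩

instance : One (AugWreath T M) := ⟨⟨fun _ => 0, 1, by simp⟩⟩

instance : Inv (AugWreath T M) where
  inv a := ⟨fun x => -a.fn (x * a.top⁻¹), a.top⁻¹, by
    rw [Finset.sum_neg_distrib, sum_translate, a.sum_fn, neg_zero]⟩

@[simp] lemma mul_fn (a b : AugWreath T M) (x : T) :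
    (a * b).fn x = a.fn x + b.fn (x * a.top) := rfl
@[simp] lemma mul_top (a b : AugWreath T M) : (a * b).top = a.top * b.top := rfl
@[simp] lemma one_fn (x : T) : (1 : AugWreath T M).fn x = 0 := rfl
@[simp] lemma one_top : (1 : AugWreath T M).top = 1 := rfl
@[simp] lemma inv_fn (a : AugWreath T M) (x : T) : (a⁻¹).fn x = -a.fn (x * a.top⁻¹) := rfl
@[simp] lemma inv_top (a : AugWreath T M) : (a⁻¹).top = a.top⁻¹ := rfl

instance : Group (AugWreath T M) :=
  Group.ofLeftAxioms
    (fun a b c => by ext <;> simp [add_assoc, mul_assoc])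
    (fun a => by ext <;> simp)
    (fun a => by ext <;> simp)

/-- Projection to the top group. -/
def topHom : AugWreath T M →* T where
  toFun := top
  map_one' := rfl
  map_mul' _ _ := rfl

lemma topHom_surjective : Function.Surjective (topHom : AugWreath T M →* T) :=
  fun t => ⟨⟨fun _ => 0, t, by simp⟩, rfl⟩

instance [Finite M] : Finite (AugWreath T M) :=
  Finite.of_injective (fun a : AugWreath T M => (a.fn, a.top)) fun a b h => by
    simp only [Prod.mk.injEq] at h
    exact AugWreath.ext h.1 h.2

/-- The automorphism induced by an automorphism of the coefficients. -/
def mapAut (α : M ≃+ M) : MulAut (AugWreath T M) where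
  toFun a := ⟨fun x => α (a.fn x), a.top, by rw [← map_sum, a.sum_fn, map_zero]⟩
  invFun a := ⟨fun x => α.symm (a.fn x), a.top, by rw [← map_sum, a.sum_fn, map_zero]⟩
  left_inv a := by ext <;> simp
  right_inv a := by ext <;> simp
  map_mul' a b := by ext <;> simp

/-- The automorphism induced by conjugation by an element of the base of the full wreath product. -/
def conjBase (w : T → M) : MulAut (AugWreath T M) where
  toFun a := ⟨fun x => a.fn x + (w x - w (x * a.top)), a.top, by
    rw [Finset.sum_add_distrib, Finset.sum_sub_distrib, sum_translate, a.sum_fn, sub_self,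
      add_zero]⟩
  invFun a := ⟨fun x => a.fn x - (w x - w (x * a.top)), a.top, by
    rw [Finset.sum_sub_distrib, Finset.sum_sub_distrib, sum_translate, a.sum_fn, sub_self,
      sub_zero]⟩
  left_inv a := by ext <;> simp
  right_inv a := by ext <;> simp
  map_mul' a b := by
    ext x
    · simp only [mul_fn, mul_top, mul_assoc]
      abel
    · rfl

end AugWreath

/-- The coefficient automorphism `μ ↦ μ + μ i • e`, where `e i = 0`. -/
def piTransvection {S R : Type} [CommRing R] (i : S) (e : S → R) (he : e i = 0) :
    (S → R) ≃+ (S → R) where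
  toFun μ := μ + μ i • e
  invFun μ := μ - μ i • e
  left_inv μ := by ext; simp [he]
  right_inv μ := by ext; simp [he]
  map_add' μ ν := by
    ext
    simp only [Pi.add_apply, Pi.smul_apply, smul_eq_mul]
    ring

lemma sum_ne_one_of_translate_eq {T : Type} [Fintype T] [Group T] {g : T} (hg : g ≠ 1)
    (u : T → ZMod (Nat.card T)) (hu : ∀ x, u (x * g) = u x) : ∑ x, u x ≠ 1 := by
  classical
  intro h
  have hinv : ∀ (x : T) (y : Subgroup.zpowers g), u (x * y) = u x := by
    rintro x ⟨_, k, rfl⟩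
    have hper : ∀ (k : ℤ) (x : T), u (x * g ^ k) = u x := by
      intro k
      induction k using Int.induction_on with
      | zero => simp
      | succ n ih => intro x; rw [zpow_add_one, ← mul_assoc, hu, ih]
      | pred n ih => intro x; rw [← hu, mul_assoc, ← zpow_add_one, sub_add_cancel, ih]
    exact hper k x
  have hsum : ∑ x, u x = (orderOf g : ZMod (Nat.card T)) *
      ∑ q : T ⧸ Subgroup.zpowers g, u q.out := by
    rw [← Finset.sum_fiberwise Finset.univ (QuotientGroup.mk : T → T ⧸ Subgroup.zpowers g),
      Finset.mul_sum]
    refine Finset.sum_congr rfl fun q _ => ?_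
    have hfib : ∀ x ∈ Finset.univ.filter fun x : T => (x : T ⧸ Subgroup.zpowers g) = q,
        u x = u q.out := by
      intro x hx
      have hxq : (x : T ⧸ Subgroup.zpowers g) = (q.out : T) := by
        rw [(Finset.mem_filter.1 hx).2, QuotientGroup.out_eq']
      simpa using (hinv x ⟨_, QuotientGroup.eq.1 hxq⟩).symm
    have hcard := QuotientGroup.card_preimage_mk (Subgroup.zpowers g) {q}
    rw [Nat.card_zpowers, Nat.card_coe_set_eq {q}, Set.ncard_singleton, mul_one,
      Nat.card_eq_fintype_card, ← Set.toFinset_card] at hcard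
    rw [Finset.sum_congr rfl hfib, Finset.sum_const, nsmul_eq_mul, ← hcard]
    congr 3
    ext x
    simp
  have hunit : IsUnit (orderOf g : ZMod (Nat.card T)) :=
    IsUnit.of_mul_eq_one _ (hsum.symm.trans h)
  rw [ZMod.isUnit_iff_coprime] at hunit
  exact hg (orderOf_eq_one_iff.1 (Nat.Coprime.eq_one_of_dvd hunit (orderOf_dvd_natCard g)))

namespace AugWreath

variable {T S : Type} [Fintype T] [Group T]

/-- If every member of a family of automorphisms indexed by a set with more than `|T|` elements
preserves the class of `g`, then two of the conjugating elements have the same top component. -/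
lemma exists_conj_pair {M : Type} [AddCommGroup M] (s : Finset S) (hs : Fintype.card T < s.card)
    (e : S → MulAut (AugWreath T M)) (g : AugWreath T M) (h : ∀ j ∈ s, IsConj g (e j g)) :
    ∃ j ∈ s, ∃ k ∈ s, j ≠ k ∧ ∃ a b : AugWreath T M, a.top = b.top ∧
      a * g = e j g * a ∧ b * g = e k g * b := by
  classical
  choose c hc using fun j : s => isConj_iff.1 (h j j.2)
  obtain ⟨j, -, k, -, hjk, h⟩ := Finset.exists_ne_map_eq_of_card_lt_of_maps_to
    (s := (Finset.univ : Finset s)) (t := (Finset.univ : Finset T)) (f := fun j => (c j).top)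
    (by simpa using hs) (fun _ _ => Finset.mem_coe.2 (Finset.mem_univ _))
  exact ⟨j, j.2, k, k.2, fun H => hjk (Subtype.ext H), c j, c k, h,
    by rw [← hc]; group, by rw [← hc]; group⟩

/-- Base elements are moved out of their class by transvections of the coefficients. -/
lemma exists_not_isConj_of_top_eq_one {R : Type} [CommRing R] [Fintype S]
    (hS : Fintype.card T + 1 < Fintype.card S) (g : AugWreath T (S → R)) (hg : g ≠ 1)
    (ht : g.top = 1) : ∃ e : MulAut (AugWreath T (S → R)), ¬ IsConj g (e g) := by
  classical
  by_contra! H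
  obtain ⟨x, i, hxi⟩ : ∃ x i, g.fn x i ≠ 0 := by
    by_contra! h
    exact hg (AugWreath.ext (funext fun x => funext (h x)) ht)
  obtain ⟨j, hj, k, hk, hjk, a, b, hab, ha, hb⟩ := exists_conj_pair (Finset.univ.erase i)
    (by rw [Finset.card_erase_of_mem (Finset.mem_univ i), Finset.card_univ]; omega)
    (fun j => if h : j ≠ i then mapAut (piTransvection i (Pi.single j (1 : R)) (by simp [h.symm]))
      else 1) g (fun _ _ => H _)
  rw [dif_pos (Finset.ne_of_mem_erase hj)] at ha
  rw [dif_pos (Finset.ne_of_mem_erase hk)] at hb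
  have h₁ := congr_fun (congr_fun (congr_arg fn ha) x) j
  have h₂ := congr_fun (congr_fun (congr_arg fn hb) x) j
  simp [mapAut, piTransvection, ht, hab, hjk] at h₁ h₂
  apply hxi
  grind

/-- Elements outside the base are moved out of their class by conjugation in the wreath product. -/
lemma exists_not_isConj_of_top_ne_one [Fintype S] (hS : Fintype.card T < Fintype.card S)
    (g : AugWreath T (S → ZMod (Nat.card T))) (ht : g.top ≠ 1) :
    ∃ e : MulAut (AugWreath T (S → ZMod (Nat.card T))), ¬ IsConj g (e g) := by
  classical
  by_contra! H
  obtain ⟨j, -, k, -, hjk, a, b, hab, ha, hb⟩ := exists_conj_pair Finset.univ hS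
    (fun j => conjBase (Pi.single 1 (Pi.single j 1))) g (fun _ _ => H _)
  let w (i : S) : T → S → ZMod (Nat.card T) := Pi.single 1 (Pi.single i 1)
  refine sum_ne_one_of_translate_eq ht (fun x => (w j x - a.fn x - (w k x - b.fn x)) j) ?_ ?_
  · intro x
    have h₁ := congr_fun (congr_fun (congr_arg fn ha) x) j
    have h₂ := congr_fun (congr_fun (congr_arg fn hb) x) j
    simp only [conjBase, mul_fn, Pi.add_apply, Pi.sub_apply, MulEquiv.coe_mk, Equiv.coe_fn_mk, hab]
      at h₁ h₂
    simp only [w, Pi.sub_apply]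
    grind
  · rw [← Finset.sum_apply, Finset.sum_sub_distrib, Finset.sum_sub_distrib,
      Finset.sum_sub_distrib, a.sum_fn, b.sum_fn, Finset.sum_pi_single', Finset.sum_pi_single']
    simp [hjk]

end AugWreath

/-- There exists a finite nonsolvable group `G` possessing no characteristic conjugacy
class of nontrivial elements: for every `g ≠ 1` some automorphism of `G` sends `g`
outside its conjugacy class. -/
theorem stmt_18 : ∃ (G : Type) (_ : Group G) (_ : Finite G),
    ¬ IsSolvable G ∧ ∀ g : G, g ≠ 1 → ∃ e : MulAut G, ¬ IsConj g (e g) := by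
  let T := Equiv.Perm (Fin 5)
  let S := Fin (Fintype.card T + 2)
  have : NeZero (Nat.card T) := ⟨Nat.card_pos.ne'⟩
  refine ⟨AugWreath T (S → ZMod (Nat.card T)), inferInstance, inferInstance, fun h => ?_,
    fun g hg => ?_⟩
  · have : Group.IsSolvable (AugWreath T (S → ZMod (Nat.card T))) := h
    exact Equiv.Perm.not_isSolvable_fin_5
      (Group.isSolvable_of_surjective
        (AugWreath.topHom_surjective (T := T) (M := S → ZMod (Nat.card T))))
  · by_cases ht : g.top = 1
    · exact AugWreath.exists_not_isConj_of_top_eq_one (by simp [S]) g hg ht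
    · exact AugWreath.exists_not_isConj_of_top_ne_one (by simp [S]) g ht
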